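/- Let v ∈ k^{r×n}, and for each nonempty J ⊆ {1,…,n} fix a matrix u^J ∈ k^{m_J×J} whose rows form a basis of ker(v_J) = {x ∈ k^J : ∑_{j∈J} x_j v_j = 0}. Let I'_v ⊆ k[x_{ij}] be the ideal generated, over all nonempty J, by all |J|×|J| minors of the (r·m_J)×|J| matrix whose entry in row (i,m) ∈ {1,…,r}×{1,…,m_J} and column j ∈ J is x_{ij}·u^J_{mj} (i.e. whose j-th column is the tensor x_j ⊗ u^J_j). Then the radical of I'_v equals the vanishing ideal I(O(v)) of the orbit; equivalently, the zero locus of I'_v is exactly X_v. -/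

import Mathlib

open MvPolynomial

noncomputable section

/-- The orbit of `v` under `GL_r(k) × (k^×)^n` acting by `(g,t)·v = g v diag(t)⁻¹`. -/
def matOrbit (k : Type*) [Field k] {r n : ℕ} (v : Matrix (Fin r) (Fin n) k) :
    Set (Matrix (Fin r) (Fin n) k) :=
  {w | ∃ g : (Matrix (Fin r) (Fin r) k)ˣ, ∃ t : Fin n → kˣ,
    w = Matrix.of fun i j => (g.1 * v) i j * ((t j)⁻¹ : kˣ)}

/-- The vanishing ideal of a set of matrices, inside `k[x_ij]`. -/
def vanIdeal (k : Type*) [Field k] {r n : ℕ} (S : Set (Matrix (Fin r) (Fin n) k)) :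
    Ideal (MvPolynomial (Fin r × Fin n) k) where
  carrier := {p | ∀ w ∈ S, eval (fun ij => w ij.1 ij.2) p = 0}
  add_mem' := by
    intro a b ha hb w hw
    simp [map_add, ha w hw, hb w hw]
  zero_mem' := by
    intro w hw; simp
  smul_mem' := by
    intro c p hp w hw
    simp [smul_eq_mul, hp w hw]

/-- The set of `|J| × |J|` minors of the matrices `x_J ⊙ u^J`, over all nonempty
`J ⊆ [n]`: the rows of the big matrix are indexed by `Fin r × Fin (m J)`, its `j`-th
column is the tensor `x_j ⊗ u^J_j`, and a `|J| × |J|` minor is the determinant of the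
square submatrix obtained from an injective selection `ρ` of `|J|` rows. -/
def minorSet (k : Type*) [Field k] {r n : ℕ} (m : Finset (Fin n) → ℕ)
    (u : (J : Finset (Fin n)) → Matrix (Fin (m J)) J k) :
    Set (MvPolynomial (Fin r × Fin n) k) :=
  {p | ∃ J : Finset (Fin n), J.Nonempty ∧
    ∃ ρ : J → Fin r × Fin (m J), Function.Injective ρ ∧
      p = Matrix.det (Matrix.of fun j j' : J =>
        (X ((ρ j).1, (j' : Fin n)) : MvPolynomial (Fin r × Fin n) k) *
          C (u J (ρ j).2 j'))}

/-- A matrix all of whose maximal minors vanish has a nonzero vector in its kernel. -/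
theorem exists_mulVec_eq_zero_of_forall_minor_eq_zero {k α ι : Type*} [Field k] [Fintype α]
    [Fintype ι] [DecidableEq ι] (M : Matrix α ι k)
    (h : ∀ ρ : ι → α, Function.Injective ρ → (M.submatrix ρ id).det = 0) :
    ∃ t : ι → k, t ≠ 0 ∧ M.mulVec t = 0 := by
  by_contra! hcon
  have hinj : Function.Injective M.mulVecLin := by
    rw [← LinearMap.ker_eq_bot, LinearMap.ker_eq_bot']
    intro t ht
    by_contra h0
    exact hcon t h0 ht
  have hrank : M.rank = Fintype.card ι := by
    rw [Matrix.rank, LinearMap.finrank_range_of_inj hinj, Module.finrank_fintype_fun_eq_card]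
  rw [Matrix.rank_eq_finrank_span_row] at hrank
  obtain ⟨f, hf, -, hli⟩ := Submodule.exists_fun_fin_finrank_span_eq k (Set.range M.row)
  choose σ hσ using hf
  let e := (Fintype.equivFinOfCardEq hrank.symm)
  have hrow : (M.submatrix (σ ∘ e) id).row = f ∘ e := by
    funext i
    exact hσ (e i)
  have hli' : LinearIndependent k (M.submatrix (σ ∘ e) id).row := by
    rw [hrow]
    exact hli.comp _ e.injective
  have hρ : Function.Injective (σ ∘ e) := by
    intro a b hab
    apply hli'.injective
    funext j
    exact congrArg (fun x => M x j) hab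
  rw [Matrix.linearIndependent_rows_iff_isUnit, Matrix.isUnit_iff_isUnit_det, h _ hρ] at hli'
  exact not_isUnit_zero hli'

/-- A matrix whose rows annihilate the kernel of `B` has its rows in the row space of `B`. -/
theorem exists_eq_mul_of_ker_le {k ι κ μ : Type*} [Field k] [Fintype ι] [Fintype κ]
    (B : Matrix κ ι k) (Y : Matrix μ ι k)
    (h : ∀ x, B.mulVec x = 0 → Y.mulVec x = 0) :
    ∃ A : Matrix μ κ k, A * B = Y := by
  classical
  have hY (i : μ) : ∃ a : κ → k, Matrix.vecMul a B = Y i := by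
    have hmem : dotProductEquiv k ι (Y i) ∈ (LinearMap.ker B.mulVecLin).dualAnnihilator := by
      rw [Submodule.mem_dualAnnihilator]
      intro x hx
      exact congrFun (h x hx) i
    rw [← LinearMap.range_dualMap_eq_dualAnnihilator_ker] at hmem
    obtain ⟨φ, hφ⟩ := hmem
    refine ⟨(dotProductEquiv k κ).symm φ, ?_⟩
    apply (dotProductEquiv k ι).injective
    rw [← hφ]
    obtain ⟨a, rfl⟩ := (dotProductEquiv k κ).surjective φ
    ext x
    simp [dotProductEquiv]
    rfl
  choose a ha using hY
  exact ⟨Matrix.of a, funext ha⟩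

/-- If every nonempty set of columns of `w` admits a nontrivial rescaling that is the image of
the corresponding columns of `v` under a linear map, then on any set `J` of columns there is a
polynomial family of linear maps that carries `v` to rescalings of columns whose leading
coefficients are nonzero multiples of those of `w`. -/
theorem exists_polynomial_degeneration {k : Type*} [Field k] {r n : ℕ}
    (v w : Matrix (Fin r) (Fin n) k)
    (H : ∀ J : Finset (Fin n), J.Nonempty → ∃ t : J → k, t ≠ 0 ∧
      ∃ A : Matrix (Fin r) (Fin r) k, ∀ i, ∀ j : J, (A * v) i j = w i j * t j)
    (J : Finset (Fin n)) :
    ∃ (A : Matrix (Fin r) (Fin r) (Polynomial k)) (e : Fin n → ℕ)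
      (q : Fin r → Fin n → Polynomial k) (t : Fin n → k), ∀ j ∈ J, t j ≠ 0 ∧
        ∀ i, (A * v.map Polynomial.C) i j = Polynomial.X ^ e j * q i j ∧
          (q i j).eval 0 = w i j * t j := by
  classical
  induction J using Finset.strongInduction with
  | H J ih =>
    rcases J.eq_empty_or_nonempty with rfl | hJ
    · exact ⟨0, 0, 0, 0, by simp⟩
    obtain ⟨t, ht, A, hA⟩ := H J hJ
    let T : Fin n → k := fun j => if h : j ∈ J then t ⟨j, h⟩ else 0
    have hT (j : Fin n) (hj : j ∈ J) (i : Fin r) : (A * v) i j = w i j * T j := by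
      simpa [T, hj] using hA i ⟨j, hj⟩
    have hss : J.filter (fun j => T j = 0) ⊂ J := by
      rw [Finset.filter_ssubset]
      obtain ⟨j, hj⟩ := Function.ne_iff.mp ht
      exact ⟨j, j.2, by simpa [T] using hj⟩
    obtain ⟨A', e, q, t', h'⟩ := ih _ hss
    have key (i : Fin r) (j : Fin n) :
        ((A.map Polynomial.C + (Polynomial.X : Polynomial k) • A') * v.map Polynomial.C) i j =
          Polynomial.C ((A * v) i j) + Polynomial.X * (A' * v.map Polynomial.C) i j := by
      rw [Matrix.add_mul, Matrix.smul_mul, ← Matrix.map_mul]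
      rfl
    refine ⟨A.map Polynomial.C + (Polynomial.X : Polynomial k) • A',
      fun j => if T j = 0 then e j + 1 else 0,
      fun i j => if T j = 0 then q i j else
        Polynomial.C (w i j * T j) + Polynomial.X * (A' * v.map Polynomial.C) i j,
      fun j => if T j = 0 then t' j else T j, fun j hj => ?_⟩
    by_cases h0 : T j = 0
    · obtain ⟨h1, h2⟩ := h' j (Finset.mem_filter.mpr ⟨hj, h0⟩)
      refine ⟨by simpa [h0] using h1, fun i => ⟨?_, by simpa [h0] using (h2 i).2⟩⟩
      rw [key, hT j hj, (h2 i).1]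
      simp only [h0, if_true, mul_zero, map_zero, zero_add]
      ring
    · refine ⟨by simp [h0], fun i => ⟨?_, by simp [h0]⟩⟩
      rw [key, hT j hj]
      simp [h0]

/-- A matrix over `k[X]` becomes nonsingular after adding a suitable large power of `X`. -/
theorem exists_det_add_X_pow_ne_zero {k ι : Type*} [Field k] [Fintype ι] [DecidableEq ι]
    (A : Matrix ι ι (Polynomial k)) (M : ℕ) :
    ∃ N, M < N ∧ (A + Matrix.scalar ι (Polynomial.X ^ N : Polynomial k)).det ≠ 0 := by
  by_contra! hcon
  refine (Matrix.charpoly_monic (-A)).ne_zero (Polynomial.eq_zero_of_infinite_isRoot _ ?_)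
  have hinj : Function.Injective fun N : ℕ => (Polynomial.X ^ N : Polynomial k) := by
    intro a b hab
    simpa using congrArg Polynomial.natDegree hab
  refine ((Set.Ioi_infinite M).image hinj.injOn).mono ?_
  rintro _ ⟨N, hN, rfl⟩
  have := hcon N hN
  rw [add_comm] at this
  simpa [Polynomial.IsRoot, Matrix.eval_charpoly] using this

/-- A matrix `w` satisfying the hypothesis of `exists_polynomial_degeneration` is a zero of every
polynomial vanishing on the orbit of `v`. -/
theorem eval_eq_zero_of_mem_vanIdeal {k : Type*} [Field k] [Infinite k] {r n : ℕ}
    (v w : Matrix (Fin r) (Fin n) k)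
    (H : ∀ J : Finset (Fin n), J.Nonempty → ∃ t : J → k, t ≠ 0 ∧
      ∃ A : Matrix (Fin r) (Fin r) k, ∀ i, ∀ j : J, (A * v) i j = w i j * t j)
    (f : MvPolynomial (Fin r × Fin n) k) (hf : f ∈ vanIdeal k (matOrbit k v)) :
    eval (fun ij => w ij.1 ij.2) f = 0 := by
  obtain ⟨A, e, q, t, h⟩ := exists_polynomial_degeneration v w H Finset.univ
  obtain ⟨N, hN, hdet⟩ := exists_det_add_X_pow_ne_zero A (Finset.univ.sup e)
  have heN (j : Fin n) : e j < N := (Finset.le_sup (Finset.mem_univ j)).trans_lt hN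
  set B := A + Matrix.scalar (Fin r) (Polynomial.X ^ N : Polynomial k) with hB
  let Q : Fin r × Fin n → Polynomial k := fun ij => Polynomial.C (t ij.2)⁻¹ *
    (q ij.1 ij.2 + Polynomial.X ^ (N - e ij.2) * Polynomial.C (v ij.1 ij.2))
  have hBv (i : Fin r) (j : Fin n) :
      (B * v.map Polynomial.C) i j = Polynomial.X ^ e j * (Polynomial.C (t j) * Q (i, j)) := by
    have ht : (Polynomial.C (t j) : Polynomial k) * Polynomial.C (t j)⁻¹ = 1 := by
      rw [← map_mul, mul_inv_cancel₀ (h j (Finset.mem_univ j)).1, map_one]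
    have hX : (Polynomial.X ^ N : Polynomial k) =
        Polynomial.X ^ e j * Polynomial.X ^ (N - e j) := by
      rw [← pow_add, Nat.add_sub_cancel' (heN j).le]
    rw [hB, Matrix.add_mul, Matrix.add_apply, ((h j (Finset.mem_univ j)).2 i).1]
    simp only [Q, Matrix.scalar_apply, Matrix.diagonal_mul, Matrix.map_apply]
    rw [hX]
    linear_combination (-(Polynomial.X ^ e j * (q i j + Polynomial.X ^ (N - e j) *
      Polynomial.C (v i j)))) * ht
  have hQ0 (ij : Fin r × Fin n) : (Q ij).eval 0 = w ij.1 ij.2 := by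
    have h1 := h ij.2 (Finset.mem_univ _)
    have h2 : N - e ij.2 ≠ 0 := (Nat.sub_pos_of_lt (heN _)).ne'
    have h3 := h1.1
    simp only [Q, Polynomial.eval_mul, Polynomial.eval_add, Polynomial.eval_C, (h1.2 ij.1).2,
      Polynomial.eval_pow, Polynomial.eval_X, zero_pow h2]
    field_simp
    ring
  have heval (s : k) : (aeval Q f).eval s = eval (fun ij => (Q ij).eval s) f := by
    have := MvPolynomial.eval₂_comp_left (Polynomial.evalRingHom s) (algebraMap k _) Q f
    rw [MvPolynomial.aeval_def]
    have hC : (Polynomial.evalRingHom s).comp (algebraMap k (Polynomial k)) = RingHom.id k := by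
      ext; simp
    rw [hC] at this
    exact this
  have hzero : aeval Q f * (Polynomial.X * B.det) = 0 := by
    refine Polynomial.eq_zero_of_infinite_isRoot _ (Set.infinite_univ.mono fun s _ => ?_)
    simp only [Set.mem_ofPred_eq, Polynomial.IsRoot, Polynomial.eval_mul, Polynomial.eval_X]
    by_cases hs : s = 0
    · simp [hs]
    by_cases hd : B.det.eval s = 0
    · simp [hd]
    rw [heval]
    have hmap : (B.map (Polynomial.eval s)).det = B.det.eval s := by
      rw [← Polynomial.coe_evalRingHom, RingHom.map_det, RingHom.mapMatrix_apply]
    have hunit : IsUnit (B.map (Polynomial.eval s)) := by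
      rw [Matrix.isUnit_iff_isUnit_det, hmap]
      exact isUnit_iff_ne_zero.mpr hd
    have hmem : (Matrix.of fun i j => (Q (i, j)).eval s) ∈ matOrbit k v := by
      refine ⟨hunit.unit, fun j => Units.mk0 (s ^ e j * t j)
        (mul_ne_zero (pow_ne_zero _ hs) (h j (Finset.mem_univ j)).1), ?_⟩
      ext i j
      have h1 : (B.map (Polynomial.eval s) * v) i j = s ^ e j * (t j * (Q (i, j)).eval s) := by
        have := congrArg (Polynomial.eval s) (hBv i j)
        simpa [Matrix.mul_apply, Polynomial.eval_finsetSum] using this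
      have h2 := (h j (Finset.mem_univ j)).1
      have h3 := pow_ne_zero (e j) hs
      simp only [Matrix.of_apply, IsUnit.unit_spec, h1, Units.val_inv_eq_inv_val, Units.val_mk0]
      field_simp
    have := hf _ hmem
    simp only [Matrix.of_apply, Prod.mk.eta] at this
    rw [this, zero_mul]
  have hf0 : aeval Q f = 0 :=
    (mul_eq_zero.mp hzero).resolve_right (mul_ne_zero Polynomial.X_ne_zero hdet)
  have := heval 0
  rw [hf0, Polynomial.eval_zero] at this
  simpa only [hQ0] using this.symm

/-- Evaluating a generator of the minor ideal gives the corresponding minor of scalars. -/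
theorem eval_det_X_mul_C {k ι σ : Type*} [Field k] [Fintype ι] [DecidableEq ι]
    (x : σ → k) (a : ι → ι → σ) (b : ι → ι → k) :
    eval x (Matrix.det (Matrix.of fun j j' : ι => (X (a j j') : MvPolynomial σ k) * C (b j j'))) =
      Matrix.det (Matrix.of fun j j' : ι => x (a j j') * b j j') := by
  rw [RingHom.map_det]
  congr 1
  ext j j'
  simp

/-- The radical of the ideal `I'_v` generated by the minors of the matrices
`x_J ⊙ (v_J)^⊥` equals the vanishing ideal of the orbit of `v`. -/
theorem radical_of_minor_ideal_eq_vanishing_ideal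
    {k : Type*} [Field k] [IsAlgClosed k] [CharZero k] {r n : ℕ}
    (v : Matrix (Fin r) (Fin n) k)
    (m : Finset (Fin n) → ℕ)
    (u : (J : Finset (Fin n)) → Matrix (Fin (m J)) J k)
    (hind : ∀ J : Finset (Fin n), J.Nonempty →
      LinearIndependent k (fun s : Fin (m J) => u J s))
    (hspan : ∀ J : Finset (Fin n), J.Nonempty →
      Submodule.span k (Set.range (u J)) =
        LinearMap.ker (Matrix.mulVecLin (Matrix.of fun i (j : J) => v i (j : Fin n)))) :
    (Ideal.span (minorSet k m u)).radical = vanIdeal k (matOrbit k v) := by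
  have hker (J : Finset (Fin n)) (hJ : J.Nonempty) (a : Fin (m J)) (i : Fin r) :
      ∑ j : J, v i j * u J a j = 0 := by
    have : u J a ∈ LinearMap.ker
        (Matrix.mulVecLin (Matrix.of fun i (j : J) => v i (j : Fin n))) := by
      rw [← hspan J hJ]
      exact Submodule.subset_span ⟨a, rfl⟩
    exact congrFun this i
  apply le_antisymm
  · have hle : Ideal.span (minorSet k m u) ≤ vanIdeal k (matOrbit k v) := by
      rw [Ideal.span_le]
      rintro _ ⟨J, hJ, ρ, -, rfl⟩ _ ⟨g, t, rfl⟩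
      rw [eval_det_X_mul_C]
      refine Matrix.exists_mulVec_eq_zero_iff.mp ⟨fun j => (t j : k), ?_, ?_⟩
      · obtain ⟨j, hj⟩ := hJ
        exact Function.ne_iff.mpr ⟨⟨j, hj⟩, (t j).ne_zero⟩
      · funext j
        have hterm (j' : J) : (g.1 * v) (ρ j).1 j' * ((t j')⁻¹ : kˣ) * u J (ρ j).2 j' * t j' =
            ∑ l, g.1 (ρ j).1 l * (v l j' * u J (ρ j).2 j') := by
          have ht : (((t j')⁻¹ : kˣ) : k) * t j' = 1 := Units.inv_mul _
          have hcancel : (g.1 * v) (ρ j).1 j' * ((t j')⁻¹ : kˣ) * u J (ρ j).2 j' * t j' =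
              (g.1 * v) (ρ j).1 j' * u J (ρ j).2 j' := by
            linear_combination ((g.1 * v) (ρ j).1 j' * u J (ρ j).2 j') * ht
          rw [hcancel, Matrix.mul_apply, Finset.sum_mul]
          exact Finset.sum_congr rfl fun l _ => mul_assoc _ _ _
        simp only [Matrix.mulVec, dotProduct, Matrix.of_apply, hterm, Pi.zero_apply]
        rw [Finset.sum_comm]
        refine Finset.sum_eq_zero fun l _ => ?_
        rw [← Finset.mul_sum, hker J hJ, mul_zero]
    rintro p ⟨N, hp⟩ w hw
    have := hle hp w hw
    rw [map_pow] at this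
    exact eq_zero_of_pow_eq_zero this
  · intro f hf
    rw [← vanishingIdeal_zeroLocus_eq_radical (K := k)]
    intro x hx
    rw [aeval_eq_eval]
    refine eval_eq_zero_of_mem_vanIdeal v (Matrix.of fun i j => x (i, j)) (fun J hJ => ?_) f hf
    obtain ⟨t, ht, hMt⟩ := exists_mulVec_eq_zero_of_forall_minor_eq_zero
      (Matrix.of fun (ia : Fin r × Fin (m J)) (j : J) => x (ia.1, j) * u J ia.2 j)
      (fun ρ hρ => by
        have := hx _ (Ideal.subset_span ⟨J, hJ, ρ, hρ, rfl⟩)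
        rw [aeval_eq_eval] at this
        exact (eval_det_X_mul_C x _ _).symm.trans this)
    obtain ⟨A, hA⟩ := exists_eq_mul_of_ker_le (Matrix.of fun i (j : J) => v i (j : Fin n))
      (Matrix.of fun (i : Fin r) (j : J) => x (i, j) * t j) (fun y hy => by
        have hy' : y ∈ Submodule.span k (Set.range (u J)) := by
          rw [hspan J hJ]
          exact hy
        change y ∈ LinearMap.ker (Matrix.mulVecLin _)
        refine (Submodule.span_le.mpr ?_ : Submodule.span k (Set.range (u J)) ≤ _) hy'
        rintro _ ⟨a, rfl⟩
        funext i
        refine Eq.trans (Finset.sum_congr rfl fun j _ => ?_) (congrFun hMt (i, a))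
        simp only [Matrix.of_apply]
        ring)
    exact ⟨t, ht, A, fun i j => congrFun (congrFun hA i) j⟩
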